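/- arXiv:2106.02231 — 3 statements merged into one kernel-verified Lean document; each statement's English description precedes it below -/
import Mathlib

section
/- Let μ > 0 and let y : [0,∞) → ℝ satisfy y(t) ≥ 0 for all t ≥ 0 and the integral inequality y(t) + μ ∫_s^t y(τ) dτ ≤ y(s) for all 0 ≤ s ≤ t. Then for every t ≥ 1/μ one has y(t) ≤ μ · e^{−μ(t − 1/μ)} · ∫_0^{1/μ} y(τ) dτ. -/
open MeasureTheory Real

/-- If `y ≥ 0` and `y t + μ ∫_s^t y ≤ y s` for `0 ≤ s ≤ t`, then `y` is nonincreasing. -/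
theorem antitoneOn_of_add_integral_le {μ : ℝ} (hμ : 0 < μ) {y : ℝ → ℝ}
    (hy_nonneg : ∀ t, 0 ≤ t → 0 ≤ y t)
    (hy : ∀ s t, 0 ≤ s → s ≤ t → y t + μ * ∫ τ in s..t, y τ ≤ y s) :
    AntitoneOn y (Set.Ici 0) := by
  intro s hs t _ hst
  have hint : 0 ≤ ∫ τ in s..t, y τ :=
    intervalIntegral.integral_nonneg hst fun u hu => hy_nonneg u (le_trans hs hu.1)
  linarith [hy s t hs hst, mul_nonneg hμ.le hint]

/-- The integral of a nonincreasing function dominates its last value times the length. -/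
theorem AntitoneOn.sub_mul_le_integral {y : ℝ → ℝ} (hanti : AntitoneOn y (Set.Ici 0))
    {s t : ℝ} (hs : 0 ≤ s) (hst : s ≤ t) : (t - s) * y t ≤ ∫ τ in s..t, y τ := by
  have hii : IntervalIntegrable y volume s t := by
    refine (hanti.mono ?_).intervalIntegrable
    rw [Set.uIcc_of_le hst]
    exact fun u hu => le_trans hs hu.1
  calc (t - s) * y t = ∫ _ in s..t, y t := by simp
    _ ≤ ∫ τ in s..t, y τ :=
      intervalIntegral.integral_mono_on hst intervalIntegrable_const hii fun u hu =>
        hanti (le_trans hs hu.1) (le_trans hs hst) hu.2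

/-- Discrete decay along a uniform grid of step `h`. -/
theorem one_add_pow_mul_le {μ : ℝ} (hμ : 0 ≤ μ) {y : ℝ → ℝ}
    (hstep : ∀ s t, 0 ≤ s → s ≤ t → (1 + μ * (t - s)) * y t ≤ y s)
    {s h : ℝ} (hs : 0 ≤ s) (hh : 0 ≤ h) (n : ℕ) :
    (1 + μ * h) ^ n * y (s + n * h) ≤ y s := by
  induction n with
  | zero => simp
  | succ n ih =>
    have hnext := hstep (s + n * h) (s + (n + 1 : ℕ) * h) (by positivity) (by push_cast; linarith)
    have hdiff : s + (n + 1 : ℕ) * h - (s + n * h) = h := by push_cast; ring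
    rw [hdiff] at hnext
    calc (1 + μ * h) ^ (n + 1) * y (s + (n + 1 : ℕ) * h)
        = (1 + μ * h) ^ n * ((1 + μ * h) * y (s + (n + 1 : ℕ) * h)) := by ring
      _ ≤ (1 + μ * h) ^ n * y (s + n * h) := by gcongr
      _ ≤ y s := ih

/-- Exponential decay from the one-step bound `(1 + μ (t - s)) y t ≤ y s`. -/
theorem exp_mul_le_of_one_add_mul_le {μ : ℝ} (hμ : 0 ≤ μ) {y : ℝ → ℝ}
    (hstep : ∀ s t, 0 ≤ s → s ≤ t → (1 + μ * (t - s)) * y t ≤ y s)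
    {s t : ℝ} (hs : 0 ≤ s) (hst : s ≤ t) : Real.exp (μ * (t - s)) * y t ≤ y s := by
  refine le_of_tendsto ((Real.tendsto_one_add_div_pow_exp (μ * (t - s))).mul_const (y t)) ?_
  filter_upwards [Filter.eventually_gt_atTop 0] with n hn
  have hn' : (n : ℝ) ≠ 0 := by positivity
  have hpow := one_add_pow_mul_le hμ hstep hs (div_nonneg (sub_nonneg.2 hst) n.cast_nonneg) n
  rwa [mul_div_cancel₀ _ hn', add_sub_cancel, ← mul_div_assoc] at hpow

/-- Lemma (Titi): if `y ≥ 0` on `[0,∞)` satisfies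
`y t + μ ∫_s^t y ≤ y s` for all `0 ≤ s ≤ t`, then for `t ≥ 1/μ`,
`y t ≤ μ e^{-μ(t - 1/μ)} ∫_0^{1/μ} y`. -/
theorem stmt_0 (μ : ℝ) (hμ : 0 < μ) (y : ℝ → ℝ)
    (hy_nonneg : ∀ t, 0 ≤ t → 0 ≤ y t)
    (hy : ∀ s t, 0 ≤ s → s ≤ t → y t + μ * ∫ τ in s..t, y τ ≤ y s) :
    ∀ t, 1 / μ ≤ t →
      y t ≤ μ * Real.exp (-μ * (t - 1 / μ)) * ∫ τ in (0 : ℝ)..(1 / μ), y τ := by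
  intro t ht
  have hanti := antitoneOn_of_add_integral_le hμ hy_nonneg hy
  have hμ' : 0 ≤ 1 / μ := by positivity
  have hstep : ∀ s t, 0 ≤ s → s ≤ t → (1 + μ * (t - s)) * y t ≤ y s := fun s t hs hst => by
    linarith [hy s t hs hst, mul_le_mul_of_nonneg_left (hanti.sub_mul_le_integral hs hst) hμ.le]
  have hexp := exp_mul_le_of_one_add_mul_le hμ.le hstep hμ' ht
  have hint := hanti.sub_mul_le_integral le_rfl hμ'
  calc y t = Real.exp (-μ * (t - 1 / μ)) * (Real.exp (μ * (t - 1 / μ)) * y t) := by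
        rw [← mul_assoc, ← Real.exp_add]; simp
    _ ≤ Real.exp (-μ * (t - 1 / μ)) * y (1 / μ) := by gcongr
    _ = μ * Real.exp (-μ * (t - 1 / μ)) * ((1 / μ - 0) * y (1 / μ)) := by field_simp; ring_nf
    _ ≤ μ * Real.exp (-μ * (t - 1 / μ)) * ∫ τ in (0 : ℝ)..(1 / μ), y τ := by gcongr
end

section
/- Let μ > 0 and let y : [0,∞) → ℝ satisfy y(t) ≥ 0 for all t ≥ 0 and the integral inequality y(t) + μ ∫_s^t y(τ) dτ ≤ y(s) for all 0 ≤ s ≤ t. Define ψ(t) = ∫_{t − 1/μ}^{t} y(τ) dτ for t ≥ 1/μ. Then for all σ, t with 1/μ ≤ σ ≤ t one has ψ(t) ≤ ψ(σ) · e^{−μ(t − σ)}. -/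
open MeasureTheory Real

/-- A continuous function satisfying the integral inequality
`f b + μ ∫_a^b f ≤ f a` decays exponentially. -/
theorem exp_decay_of_integral_inequality {μ σ t : ℝ} (hμ : 0 < μ) (hσt : σ ≤ t) {f : ℝ → ℝ}
    (hf : Continuous f)
    (h : ∀ s, σ ≤ s → s ≤ t → f t + μ * ∫ τ in s..t, f τ ≤ f s) :
    f t ≤ f σ * Real.exp (-μ * (t - σ)) := by
  have hderiv (s : ℝ) : HasDerivAt
      (fun s ↦ (f t + μ * ∫ τ in s..t, f τ) * Real.exp (μ * s))
      ((μ * -f s) * Real.exp (μ * s)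
        + (f t + μ * ∫ τ in s..t, f τ) * (Real.exp (μ * s) * (μ * 1))) s :=
    (((intervalIntegral.integral_hasDerivAt_left (hf.intervalIntegrable _ _)
      (hf.stronglyMeasurableAtFilter _ _) hf.continuousAt).const_mul μ).const_add (f t)).mul
      (((hasDerivAt_id s).const_mul μ).exp)
  have hanti : AntitoneOn (fun s ↦ (f t + μ * ∫ τ in s..t, f τ) * Real.exp (μ * s))
      (Set.Icc σ t) := by
    refine antitoneOn_of_deriv_nonpos (convex_Icc σ t)
      (fun s _ ↦ (hderiv s).continuousAt.continuousWithinAt)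
      (fun s _ ↦ (hderiv s).differentiableAt.differentiableWithinAt) fun s hs ↦ ?_
    rw [interior_Icc] at hs
    rw [(hderiv s).deriv]
    have := mul_nonneg (mul_nonneg hμ.le (Real.exp_pos (μ * s)).le)
      (sub_nonneg.2 (h s hs.1.le hs.2.le))
    linarith
  have hle := hanti (Set.left_mem_Icc.2 hσt) (Set.right_mem_Icc.2 hσt) hσt
  simp only [intervalIntegral.integral_same, mul_zero, add_zero] at hle
  have hexp : Real.exp (-μ * (t - σ)) = Real.exp (μ * σ) / Real.exp (μ * t) := by
    rw [← Real.exp_sub]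
    ring_nf
  rw [hexp, ← mul_div_assoc, le_div_iff₀ (Real.exp_pos _)]
  exact hle.trans (mul_le_mul_of_nonneg_right (h σ le_rfl hσt) (Real.exp_pos _).le)

/-- The sliding integral `ψ(t) = ∫_{t-1/μ}^t y` decays exponentially:
`ψ(t) ≤ ψ(σ) e^{-μ(t-σ)}` for `1/μ ≤ σ ≤ t`. -/
theorem stmt_2 (μ : ℝ) (hμ : 0 < μ) (y : ℝ → ℝ)
    (hy_nonneg : ∀ t, 0 ≤ t → 0 ≤ y t)
    (hy : ∀ s t, 0 ≤ s → s ≤ t → y t + μ * ∫ τ in s..t, y τ ≤ y s) :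
    ∀ σ t, 1 / μ ≤ σ → σ ≤ t →
      (∫ τ in (t - 1 / μ)..t, y τ) ≤
        (∫ τ in (σ - 1 / μ)..σ, y τ) * Real.exp (-μ * (t - σ)) := by
  intro σ t hσ hσt
  have hμ' : 0 < 1 / μ := by positivity
  set z : ℝ → ℝ := fun τ ↦ y (max τ 0) with hz
  have hzy {a b : ℝ} (ha : 0 ≤ a) (hab : a ≤ b) : ∫ τ in a..b, y τ = ∫ τ in a..b, z τ := by
    refine intervalIntegral.integral_congr fun τ hτ ↦ ?_
    rw [Set.uIcc_of_le hab] at hτ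
    simp [hz, max_eq_left (ha.trans hτ.1)]
  have hanti : Antitone z := fun a b hab ↦ by
    have hmax : max a 0 ≤ max b 0 := max_le_max_right 0 hab
    have hint : 0 ≤ ∫ τ in (max a 0)..(max b 0), y τ :=
      intervalIntegral.integral_nonneg hmax fun τ hτ ↦
        hy_nonneg τ ((le_max_right a 0).trans hτ.1)
    have := hy _ _ (le_max_right a 0) hmax
    have := mul_nonneg hμ.le hint
    simp only [hz]
    linarith
  have hzint (a b : ℝ) : IntervalIntegrable z volume a b := hanti.intervalIntegrable
  have hcont : Continuous fun s ↦ ∫ τ in (s - 1 / μ)..s, z τ := by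
    have hprim : Continuous fun s ↦ ∫ τ in (0 : ℝ)..s, z τ :=
      intervalIntegral.continuous_primitive hzint 0
    have heq : (fun s ↦ ∫ τ in (s - 1 / μ)..s, z τ) =
        fun s ↦ (∫ τ in (0 : ℝ)..s, z τ) - ∫ τ in (0 : ℝ)..(s - 1 / μ), z τ :=
      funext fun s ↦ (intervalIntegral.integral_interval_sub_left (hzint _ _) (hzint _ _)).symm
    rw [heq]
    exact hprim.sub (hprim.comp (continuous_id.sub continuous_const))
  rw [hzy (by linarith) (by linarith), hzy (by linarith) (by linarith)]
  refine exp_decay_of_integral_inequality hμ hσt hcont fun s hs hst ↦ ?_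
  have hshift : ∫ τ in s..t, z (τ - 1 / μ) = ∫ τ in (s - 1 / μ)..(t - 1 / μ), z τ :=
    intervalIntegral.integral_comp_sub_right z (1 / μ)
  have hshift_int : IntervalIntegrable (fun τ ↦ z (τ - 1 / μ)) volume s t :=
    (hanti.comp_monotone fun a b hab ↦ sub_le_sub_right hab _).intervalIntegrable
  have hmono : ∫ τ in s..t, (z τ + μ * ∫ x in (τ - 1 / μ)..τ, z x) ≤
      ∫ τ in s..t, z (τ - 1 / μ) := by
    refine intervalIntegral.integral_mono_on hst
      ((hzint s t).add ((hcont.intervalIntegrable s t).const_mul μ)) hshift_int fun τ hτ ↦ ?_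
    have hτ0 : 0 ≤ τ - 1 / μ := by linarith [hτ.1]
    have hττ : τ - 1 / μ ≤ τ := by linarith
    have := hy _ _ hτ0 hττ
    rw [hzy hτ0 hττ] at this
    simpa only [hz, max_eq_left hτ0, max_eq_left (hτ0.trans hττ)] using this
  rw [intervalIntegral.integral_add (hzint s t) ((hcont.intervalIntegrable s t).const_mul μ),
    intervalIntegral.integral_const_mul, hshift] at hmono
  have h₁ := intervalIntegral.integral_add_adjacent_intervals
    (hzint (s - 1 / μ) s) (hzint s t)
  have h₂ := intervalIntegral.integral_add_adjacent_intervals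
    (hzint (s - 1 / μ) (t - 1 / μ)) (hzint (t - 1 / μ) t)
  linarith
end

section
/- Let 1 ≤ p < ∞. There exists a constant C > 0, depending only on p (and the dimension 3), such that for every h > 0, every open cube U ⊂ ℝ³ of side length h, and every function u that is continuously differentiable on an open neighborhood of the closure of U, one has (∫_U |u(x) − (u)_U|^p dx)^{1/p} ≤ C · h · (∫_U ‖∇u(x)‖^p dx)^{1/p}, where (u)_U = (1/|U|) ∫_U u(x) dx. -/
open MeasureTheory

/-- Jensen's inequality for `r ↦ r ^ p` in extended nonnegative form. -/
theorem enorm_integral_rpow_le_lintegral {α F : Type*} [MeasurableSpace α]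
    [NormedAddCommGroup F] [NormedSpace ℝ F] (μ : Measure α) [IsProbabilityMeasure μ]
    {p : ℝ} (hp : 1 ≤ p) {f : α → F} (hf : AEStronglyMeasurable f μ) :
    ‖∫ x, f x ∂μ‖ₑ ^ p ≤ ∫⁻ x, ‖f x‖ₑ ^ p ∂μ := by
  rw [lintegral_rpow_enorm_eq_rpow_eLpNorm' (by linarith)]
  gcongr
  calc ‖∫ x, f x ∂μ‖ₑ ≤ ∫⁻ x, ‖f x‖ₑ ∂μ := enorm_integral_le_lintegral_enorm f
    _ = eLpNorm' f 1 μ := by simp [eLpNorm'_eq_lintegral_enorm]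
    _ ≤ eLpNorm' f p μ := eLpNorm'_le_eLpNorm'_of_exponent_le one_pos hp μ hf

section Convex

variable {E : Type*} [NormedAddCommGroup E] [NormedSpace ℝ E] {s : Set E} {u : E → ℝ}

theorem enorm_sub_rpow_le_lintegral_fderiv {p : ℝ} (hp : 1 ≤ p) (hs : Convex ℝ s)
    (ho : IsOpen s) (hu : ContDiffOn ℝ 1 u s) {x y : E} (hx : x ∈ s) (hy : y ∈ s) :
    ‖u y - u x‖ₑ ^ p ≤
      ‖y - x‖ₑ ^ p * ∫⁻ t in Set.Ioc (0 : ℝ) 1, ‖fderiv ℝ u (x + t • (y - x))‖ₑ ^ p := by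
  have hmem : ∀ t ∈ Set.Icc (0 : ℝ) 1, x + t • (y - x) ∈ s :=
    fun t ht ↦ hs.add_smul_sub_mem hx hy ht
  have hcd : ContinuousOn (fun t : ℝ ↦ fderiv ℝ u (x + t • (y - x)) (y - x)) (Set.Icc 0 1) := by
    refine ContinuousOn.clm_apply ?_ continuousOn_const
    exact (hu.continuousOn_fderiv_of_isOpen ho le_rfl).comp (by fun_prop) hmem
  have hder : ∀ t ∈ Set.uIcc (0 : ℝ) 1, HasDerivAt (fun t : ℝ ↦ u (x + t • (y - x)))
      (fderiv ℝ u (x + t • (y - x)) (y - x)) t := by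
    intro t ht
    rw [Set.uIcc_of_le zero_le_one] at ht
    have h1 : HasFDerivAt u (fderiv ℝ u (x + t • (y - x))) (x + t • (y - x)) :=
      ((hu.differentiableOn one_ne_zero).differentiableAt
        (ho.mem_nhds (hmem t ht))).hasFDerivAt
    have h2 : HasDerivAt (fun t : ℝ ↦ x + t • (y - x)) (y - x) t := by
      simpa using ((hasDerivAt_id t).smul_const (y - x)).const_add x
    exact h1.comp_hasDerivAt t h2
  have hftc := intervalIntegral.integral_eq_sub_of_hasDerivAt hder
    (ContinuousOn.intervalIntegrable (by rwa [Set.uIcc_of_le zero_le_one]))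
  rw [intervalIntegral.integral_of_le zero_le_one] at hftc
  simp only [one_smul, zero_smul, add_zero, add_sub_cancel] at hftc
  have : IsProbabilityMeasure (volume.restrict (Set.Ioc (0 : ℝ) 1)) := ⟨by simp⟩
  rw [← hftc]
  refine (enorm_integral_rpow_le_lintegral _ hp
    ((hcd.mono Set.Ioc_subset_Icc_self).aestronglyMeasurable measurableSet_Ioc)).trans ?_
  rw [← lintegral_const_mul' _ _ (ENNReal.rpow_ne_top_of_nonneg (by linarith) enorm_ne_top)]
  refine lintegral_mono fun t ↦ ?_
  rw [← ENNReal.mul_rpow_of_nonneg _ _ (by linarith), mul_comm]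
  gcongr
  exact ContinuousLinearMap.le_opENorm _ _

variable [MeasurableSpace E] [BorelSpace E] [FiniteDimensional ℝ E]
  (μ : Measure E) [μ.IsAddHaarMeasure]

theorem lintegral_comp_add_smul_sub_le {G : E → ENNReal} (hG : Measurable G) {t : ℝ}
    (ht : 1 / 2 ≤ t) (x : E) :
    ∫⁻ y, G (x + t • (y - x)) ∂μ ≤ 2 ^ Module.finrank ℝ E * ∫⁻ y, G y ∂μ := by
  have ht0 : 0 < t := by linarith
  have h1 : ∀ y, x + t • (y - x) = t • y + (x - t • x) := fun y ↦ by module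
  simp_rw [h1]
  rw [← lintegral_map (f := fun z ↦ G (z + (x - t • x))) (g := fun y : E ↦ t • y)
    (by fun_prop) (by fun_prop), Measure.map_addHaar_smul μ ht0.ne', lintegral_smul_measure,
    lintegral_add_right_eq_self]
  rw [smul_eq_mul]
  gcongr
  rw [abs_of_pos (by positivity), ← inv_pow, ENNReal.ofReal_pow (by positivity)]
  gcongr
  rw [show (2 : ENNReal) = ENNReal.ofReal 2 by simp]
  gcongr
  rw [inv_le_comm₀ ht0 two_pos]
  linarith

theorem lintegral_lintegral_comp_add_smul_sub_le {G : E → ENNReal} (hG : Measurable G)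
    (hfin : μ s ≠ ⊤) (t : ℝ) :
    ∫⁻ x in s, ∫⁻ y in s, G (x + t • (y - x)) ∂μ ∂μ ≤
      2 ^ Module.finrank ℝ E * (∫⁻ y, G y ∂μ) * μ s := by
  have key : ∀ t : ℝ, 1 / 2 ≤ t → ∫⁻ x in s, ∫⁻ y in s, G (x + t • (y - x)) ∂μ ∂μ ≤
      2 ^ Module.finrank ℝ E * (∫⁻ y, G y ∂μ) * μ s := by
    intro t ht
    rw [← setLIntegral_const]
    exact lintegral_mono fun x ↦ (setLIntegral_le_lintegral _ _).trans
      (lintegral_comp_add_smul_sub_le μ hG ht x)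
  rcases le_total (1 / 2) t with ht | ht
  · exact key t ht
  · have : Fact (μ s < ⊤) := ⟨hfin.lt_top⟩
    rw [lintegral_lintegral_swap (by fun_prop)]
    convert! key (1 - t) (by linarith) using 6
    module

/-- Poincaré–Wirtinger inequality on a bounded open convex set of diameter at most `d`. -/
theorem lintegral_enorm_sub_average_rpow_le {p : ℝ} (hp : 1 ≤ p) (hs : Convex ℝ s)
    (ho : IsOpen s) (hne : s.Nonempty) (hfin : μ s ≠ ⊤) {d : ENNReal}
    (hd : ∀ x ∈ s, ∀ y ∈ s, ‖y - x‖ₑ ≤ d) (hdtop : d ≠ ⊤)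
    (hu : ContDiffOn ℝ 1 u s) (hint : IntegrableOn u s μ) :
    ∫⁻ x in s, ‖u x - ⨍ y in s, u y ∂μ‖ₑ ^ p ∂μ ≤
      2 ^ Module.finrank ℝ E * d ^ p * ∫⁻ x in s, ‖fderiv ℝ u x‖ₑ ^ p ∂μ := by
  have hp0 : 0 ≤ p := by linarith
  have hμ0 : μ s ≠ 0 := (ho.measure_pos μ hne).ne'
  have : Fact (μ s < ⊤) := ⟨hfin.lt_top⟩
  set G : E → ENNReal := s.indicator fun x ↦ ‖fderiv ℝ u x‖ₑ ^ p with hGdef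
  have hG : Measurable G :=
    ((measurable_fderiv ℝ u).enorm.pow_const p).indicator ho.measurableSet
  have hGint : ∫⁻ x, G x ∂μ = ∫⁻ x in s, ‖fderiv ℝ u x‖ₑ ^ p ∂μ :=
    lintegral_indicator ho.measurableSet _
  have hpt : ∀ x ∈ s, ∀ y ∈ s,
      ‖u x - u y‖ₑ ^ p ≤ d ^ p * ∫⁻ t in Set.Ioc (0 : ℝ) 1, G (x + t • (y - x)) := by
    intro x hx y hy
    rw [enorm_sub_rev]
    refine (enorm_sub_rpow_le_lintegral_fderiv hp hs ho hu hx hy).trans ?_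
    gcongr ?_ ^ p * ?_
    · exact hd x hx y hy
    · refine (setLIntegral_congr_fun measurableSet_Ioc fun t ht ↦ ?_).le
      have := hs.add_smul_sub_mem hx hy (Set.Ioc_subset_Icc_self ht)
      simp [hGdef, this]
  have hmean : ∀ x, ‖u x - ⨍ y in s, u y ∂μ‖ₑ ^ p ≤
      (μ s)⁻¹ * ∫⁻ y in s, ‖u x - u y‖ₑ ^ p ∂μ := by
    intro x
    have : IsProbabilityMeasure ((μ s)⁻¹ • μ.restrict s) :=
      ⟨by simp [ENNReal.inv_mul_cancel hμ0 hfin]⟩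
    have hint' : Integrable u ((μ s)⁻¹ • μ.restrict s) :=
      hint.integrable.smul_measure (ENNReal.inv_ne_top.2 hμ0)
    have h1 : u x - ⨍ y in s, u y ∂μ = ∫ y, (u x - u y) ∂((μ s)⁻¹ • μ.restrict s) := by
      rw [integral_sub (integrable_const _) hint']
      simp [average]
    rw [h1, ← smul_eq_mul, ← lintegral_smul_measure]
    exact enorm_integral_rpow_le_lintegral _ hp
      (aestronglyMeasurable_const.sub hint'.aestronglyMeasurable)
  have hdp : d ^ p ≠ ⊤ := ENNReal.rpow_ne_top_of_nonneg hp0 hdtop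
  have hμi : (μ s)⁻¹ ≠ ⊤ := ENNReal.inv_ne_top.2 hμ0
  calc ∫⁻ x in s, ‖u x - ⨍ y in s, u y ∂μ‖ₑ ^ p ∂μ
      ≤ ∫⁻ x in s, (μ s)⁻¹ * (d ^ p *
          ∫⁻ y in s, (∫⁻ t in Set.Ioc (0 : ℝ) 1, G (x + t • (y - x))) ∂μ) ∂μ := by
        refine setLIntegral_mono' ho.measurableSet fun x hx ↦ (hmean x).trans ?_
        gcongr
        rw [← lintegral_const_mul' _ _ hdp]
        exact setLIntegral_mono' ho.measurableSet fun y hy ↦ hpt x hx y hy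
    _ = (μ s)⁻¹ * (d ^ p * ∫⁻ x in s, (∫⁻ t in Set.Ioc (0 : ℝ) 1,
          ∫⁻ y in s, G (x + t • (y - x)) ∂μ) ∂μ) := by
        rw [lintegral_const_mul' _ _ hμi, lintegral_const_mul' _ _ hdp]
        congr 3
        ext x
        exact lintegral_lintegral_swap (by fun_prop)
    _ = (μ s)⁻¹ * (d ^ p * ∫⁻ t in Set.Ioc (0 : ℝ) 1, ∫⁻ x in s,
          ∫⁻ y in s, G (x + t • (y - x)) ∂μ ∂μ) := by
        rw [lintegral_lintegral_swap]
        refine (Measurable.lintegral_prod_right'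
          (f := fun q : (E × ℝ) × E ↦ G (q.1.1 + q.1.2 • (q.2 - q.1.1))) ?_).aemeasurable
        fun_prop
    _ ≤ (μ s)⁻¹ * (d ^ p * ∫⁻ t in Set.Ioc (0 : ℝ) 1,
          2 ^ Module.finrank ℝ E * (∫⁻ y, G y ∂μ) * μ s) := by
        gcongr
        exact lintegral_lintegral_comp_add_smul_sub_le μ hG hfin _
    _ = ((μ s)⁻¹ * μ s) * (2 ^ Module.finrank ℝ E * d ^ p * ∫⁻ y, G y ∂μ) := by
        simp only [lintegral_const, MeasurableSet.univ, Measure.restrict_apply, Set.univ_inter,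
          Real.volume_Ioc, sub_zero, ENNReal.ofReal_one, mul_one]
        ring
    _ = _ := by rw [ENNReal.inv_mul_cancel hμ0 hfin, one_mul, hGint]

end Convex

theorem integral_norm_rpow_eq_toReal_lintegral {α F : Type*} [MeasurableSpace α]
    [NormedAddCommGroup F] {μ : Measure α} {p : ℝ} (hp : 0 ≤ p) {f : α → F}
    (hf : AEStronglyMeasurable f μ) :
    ∫ x, ‖f x‖ ^ p ∂μ = (∫⁻ x, ‖f x‖ₑ ^ p ∂μ).toReal := by
  rw [integral_eq_lintegral_of_nonneg_ae (.of_forall fun x ↦ by positivity)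
    (hf.norm.aemeasurable.pow_const p).aestronglyMeasurable]
  congr 2 with x
  rw [← ENNReal.ofReal_rpow_of_nonneg (norm_nonneg _) hp, ofReal_norm]

section Cube

variable {ι : Type*}

theorem setOf_forall_mem_Ioo_eq_preimage (a b : ι → ℝ) :
    {x : EuclideanSpace ℝ ι | ∀ i, x i ∈ Set.Ioo (a i) (b i)} =
      WithLp.ofLp ⁻¹' Set.univ.pi fun i ↦ Set.Ioo (a i) (b i) := by
  ext x
  simp [Set.mem_pi]

theorem convex_setOf_forall_mem_Ioo (a b : ι → ℝ) :
    Convex ℝ {x : EuclideanSpace ℝ ι | ∀ i, x i ∈ Set.Ioo (a i) (b i)} := by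
  rw [setOf_forall_mem_Ioo_eq_preimage]
  exact (convex_pi fun i _ ↦ convex_Ioo (a i) (b i)).linear_preimage
    (WithLp.linearEquiv 2 ℝ (ι → ℝ)).toLinearMap

variable [Fintype ι]

theorem isOpen_setOf_forall_mem_Ioo (a b : ι → ℝ) :
    IsOpen {x : EuclideanSpace ℝ ι | ∀ i, x i ∈ Set.Ioo (a i) (b i)} := by
  rw [setOf_forall_mem_Ioo_eq_preimage]
  exact (isOpen_set_pi Set.finite_univ fun i _ ↦ isOpen_Ioo).preimage
    (PiLp.continuous_ofLp 2 _)

theorem volume_setOf_forall_mem_Ioo (a b : ι → ℝ) :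
    volume {x : EuclideanSpace ℝ ι | ∀ i, x i ∈ Set.Ioo (a i) (b i)} =
      ∏ i, ENNReal.ofReal (b i - a i) := by
  rw [setOf_forall_mem_Ioo_eq_preimage, (PiLp.volume_preserving_ofLp ι).measure_preimage
    (MeasurableSet.univ_pi fun i ↦ measurableSet_Ioo).nullMeasurableSet, Real.volume_pi_Ioo]

theorem norm_sub_le_of_forall_mem_Ioo {h : ℝ} (hh : 0 ≤ h) {a : ι → ℝ}
    {x y : EuclideanSpace ℝ ι} (hx : ∀ i, x i ∈ Set.Ioo (a i) (a i + h))
    (hy : ∀ i, y i ∈ Set.Ioo (a i) (a i + h)) :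
    ‖y - x‖ ≤ √(Fintype.card ι) * h := by
  have hle : ∑ i, ‖(y - x) i‖ ^ 2 ≤ ∑ _i : ι, h ^ 2 := by
    refine Finset.sum_le_sum fun i _ ↦ ?_
    gcongr
    rw [PiLp.sub_apply, Real.norm_eq_abs, abs_le]
    constructor <;> linarith [(hx i).1, (hx i).2, (hy i).1, (hy i).2]
  rw [EuclideanSpace.norm_eq]
  refine (Real.sqrt_le_sqrt hle).trans_eq ?_
  rw [Finset.sum_const, nsmul_eq_mul, Real.sqrt_mul (by positivity), Real.sqrt_sq hh,
    Finset.card_univ]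

end Cube

/-- Scaled Poincaré–Wirtinger inequality on a cube: for `1 ≤ p < ∞` there is a
constant `C = C(p)` such that for every axis-parallel open cube `U ⊆ ℝ³` of side
length `h` and every `u` continuously differentiable on a neighborhood of the
closure of `U`,
`(∫_U |u - (u)_U|^p)^{1/p} ≤ C h (∫_U ‖∇u‖^p)^{1/p}`,
where `(u)_U = (1/h³) ∫_U u` is the mean value of `u` over `U`. -/
theorem stmt_10 (p : ℝ) (hp : 1 ≤ p) :
    ∃ C : ℝ, 0 < C ∧
      ∀ h : ℝ, 0 < h → ∀ a : Fin 3 → ℝ,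
        ∀ u : EuclideanSpace ℝ (Fin 3) → ℝ, ∀ V : Set (EuclideanSpace ℝ (Fin 3)),
          IsOpen V →
          closure {x : EuclideanSpace ℝ (Fin 3) | ∀ i, x i ∈ Set.Ioo (a i) (a i + h)} ⊆ V →
          ContDiffOn ℝ 1 u V →
          (∫ x in {x : EuclideanSpace ℝ (Fin 3) | ∀ i, x i ∈ Set.Ioo (a i) (a i + h)},
              |u x - (1 / h ^ 3) *
                ∫ y in {x : EuclideanSpace ℝ (Fin 3) | ∀ i, x i ∈ Set.Ioo (a i) (a i + h)},
                  u y| ^ p) ^ (1 / p)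
            ≤ C * h *
              (∫ x in {x : EuclideanSpace ℝ (Fin 3) | ∀ i, x i ∈ Set.Ioo (a i) (a i + h)},
                  ‖fderiv ℝ u x‖ ^ p) ^ (1 / p) := by
  have hp0 : 0 < p := by linarith
  refine ⟨8 ^ (1 / p) * √3, by positivity, fun h hh a u V hV hUV hu ↦ ?_⟩
  set U : Set (EuclideanSpace ℝ (Fin 3)) := {x | ∀ i, x i ∈ Set.Ioo (a i) (a i + h)} with hU
  have hconv : Convex ℝ U := convex_setOf_forall_mem_Ioo a fun i ↦ a i + h
  have ho : IsOpen U := isOpen_setOf_forall_mem_Ioo a fun i ↦ a i + h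
  have hvol : volume U = ENNReal.ofReal (h ^ 3) := by
    rw [hU, volume_setOf_forall_mem_Ioo a fun i ↦ a i + h]
    simp [ENNReal.ofReal_pow hh.le]
  have hne : U.Nonempty := nonempty_of_measure_ne_zero (μ := volume) (by
    rw [hvol]
    exact (ENNReal.ofReal_pos.2 (by positivity)).ne')
  have hdiam : ∀ x ∈ U, ∀ y ∈ U, ‖y - x‖ ≤ √3 * h := fun x hx y hy ↦ by
    simpa using norm_sub_le_of_forall_mem_Ioo hh.le hx hy
  have hbdd : Bornology.IsBounded U := Metric.isBounded_iff.2
    ⟨√3 * h, fun x hx y hy ↦ by rw [dist_comm, dist_eq_norm]; exact hdiam x hx y hy⟩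
  have hcpt : IsCompact (closure U) := hbdd.isCompact_closure
  have hint : IntegrableOn u U :=
    ((hu.continuousOn.mono hUV).integrableOn_compact hcpt).mono_set subset_closure
  have hgrad : IntegrableOn (fun x ↦ ‖fderiv ℝ u x‖ ^ p) U := by
    refine ContinuousOn.integrableOn_compact hcpt ?_ |>.mono_set subset_closure
    exact ((hu.continuousOn_fderiv_of_isOpen hV le_rfl).mono hUV).norm.rpow_const
      fun _ _ ↦ .inr hp0.le
  have hfin : ∫⁻ x in U, ‖fderiv ℝ u x‖ₑ ^ p ≠ ⊤ := by
    convert! hgrad.hasFiniteIntegral.ne using 3 with x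
    rw [Real.enorm_rpow_of_nonneg (norm_nonneg _) hp0.le, enorm_norm]
  have havg : 1 / h ^ 3 * ∫ y in U, u y = ⨍ y in U, u y := by
    rw [setAverage_eq, measureReal_def, hvol, ENNReal.toReal_ofReal (by positivity), one_div,
      smul_eq_mul]
  have hmain := lintegral_enorm_sub_average_rpow_le volume hp hconv ho hne
    (by simp [hvol]) (d := ENNReal.ofReal (√3 * h)) (fun x hx y hy ↦ by
      rw [← ofReal_norm]
      exact ENNReal.ofReal_le_ofReal (hdiam x hx y hy)) ENNReal.ofReal_ne_top
    (hu.mono (subset_closure.trans hUV)) hint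
  rw [finrank_euclideanSpace_fin] at hmain
  have hreal := ENNReal.toReal_mono (by finiteness) hmain
  rw [ENNReal.toReal_mul, ENNReal.toReal_mul, ← ENNReal.toReal_rpow,
    ENNReal.toReal_ofReal (by positivity), ← integral_norm_rpow_eq_toReal_lintegral hp0.le
      (f := fun x ↦ u x - ⨍ y in U, u y)
      (hint.aestronglyMeasurable.sub aestronglyMeasurable_const),
    ← integral_norm_rpow_eq_toReal_lintegral hp0.le
      (measurable_fderiv ℝ u).aestronglyMeasurable] at hreal
  rw [havg]
  have h8 : ((2 : ENNReal) ^ 3).toReal = 8 := by norm_num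
  rw [h8] at hreal
  calc _ ≤ (8 * (√3 * h) ^ p * ∫ x in U, ‖fderiv ℝ u x‖ ^ p) ^ (1 / p) := by
        gcongr
        exact hreal
    _ = _ := by
        rw [Real.mul_rpow (by positivity) (by positivity), Real.mul_rpow (by positivity)
          (by positivity), ← Real.rpow_mul (by positivity), mul_one_div_cancel hp0.ne',
          Real.rpow_one]
        ring
end
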